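/- Let G be a finite simple connected bipartite graph in which every vertex is pseudo-distance-regular. Then G is distance-biregular. -/

import Mathlib

open Polynomial Matrix

/-- The distance-`i` matrix of a graph: `(A_i)_{u,v} = 1` if `d(u,v) = i` and `0` otherwise. -/
noncomputable def distMatrix {V : Type*} [Fintype V] (G : SimpleGraph V) (i : ℕ) :
    Matrix V V ℝ :=
  Matrix.of fun u v => if G.dist u v = i then 1 else 0

/-- `G` has diameter `d`. -/
def IsDiam {V : Type*} (G : SimpleGraph V) (d : ℕ) : Prop :=
  (∀ u v, G.dist u v ≤ d) ∧ ∃ u v, G.dist u v = d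

/-- `u` has eccentricity `e` in `G`. -/
def IsEcc {V : Type*} (G : SimpleGraph V) (u : V) (e : ℕ) : Prop :=
  (∀ v, G.dist u v ≤ e) ∧ ∃ v, G.dist u v = e

/-- `(B, C)` is a bipartition of `G`. -/
def IsBipartition {V : Type*} (G : SimpleGraph V) (B C : Finset V) : Prop :=
  (∀ v, v ∈ B ∨ v ∈ C) ∧ (∀ v, ¬(v ∈ B ∧ v ∈ C)) ∧
    ∀ u v, G.Adj u v → ((u ∈ B ∧ v ∈ C) ∨ (u ∈ C ∧ v ∈ B))

/-- The eigenvalue support of the vertex `u`. -/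
def eSupport {V : Type*} [Fintype V] (A : Matrix V V ℝ) (u : V) : Set ℝ :=
  {θ : ℝ | ∃ w : V → ℝ, A *ᵥ w = θ • w ∧ w u ≠ 0}

/-- The vertex `u`, of eccentricity `e`, is pseudo-distance-regular. -/
def IsPseudoDistRegular {V : Type*} [Fintype V] [DecidableEq V] (G : SimpleGraph V)
    (A : Matrix V V ℝ) (u : V) (e : ℕ) : Prop :=
  (eSupport A u).ncard = e + 1 ∧
    ∀ i ≤ e, ∃ p : Polynomial ℝ, p.degree = (i : WithBot ℕ) ∧
      ∀ w, (aeval A p *ᵥ Pi.single u 1) w ≠ 0 ↔ G.dist u w = i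

/-- `G` with bipartition `(B,C)`, adjacency matrix `A` and diameter `d` is distance-biregular. -/
def IsDistBiregular {V : Type*} [Fintype V] [DecidableEq V] (G : SimpleGraph V)
    (A : Matrix V V ℝ) (B C : Finset V) (d : ℕ) : Prop :=
  (spectrum ℝ A).ncard = d + 1 ∧
    ∃ pB pC : ℕ → Polynomial ℝ, ∀ i ≤ d,
      (pB i).degree = (i : WithBot ℕ) ∧ (pC i).degree = (i : WithBot ℕ) ∧
      (∀ b ∈ B, aeval A (pB i) *ᵥ Pi.single b 1 = distMatrix G i *ᵥ Pi.single b 1) ∧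
      (∀ c ∈ C, aeval A (pC i) *ᵥ Pi.single c 1 = distMatrix G i *ᵥ Pi.single c 1)


section SpectralDecomposition

variable {V : Type*} [Fintype V] [DecidableEq V]

theorem aeval_mulVec_of_mulVec_eq_smul {A : Matrix V V ℝ} {θ : ℝ} {w : V → ℝ}
    (h : A *ᵥ w = θ • w) (q : ℝ[X]) : aeval A q *ᵥ w = q.eval θ • w := by
  induction q using Polynomial.induction_on' with
  | add p q hp hq => simp [Matrix.add_mulVec, hp, hq, add_smul]
  | monomial n a =>
    have key : ∀ n : ℕ, A ^ n *ᵥ w = θ ^ n • w := by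
      intro n
      induction n with
      | zero => simp
      | succ n ih => rw [pow_succ, ← mulVec_mulVec, h, mulVec_smul, ih, smul_smul, pow_succ']
    rw [aeval_monomial, eval_monomial, ← Algebra.smul_def, smul_mulVec, key, smul_smul]

/-- Spectral decomposition of all polynomials in a real symmetric matrix. -/
theorem Matrix.IsHermitian.exists_eigen_decomposition {A : Matrix V V ℝ} (hA : A.IsHermitian) :
    ∃ (μ : V → ℝ) (φ : V → V → ℝ), spectrum ℝ A = Set.range μ ∧
      (∀ j, A *ᵥ φ j = μ j • φ j) ∧ (∀ j, φ j ≠ 0) ∧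
      ∀ (q : ℝ[X]) (x u : V), aeval A q x u = ∑ j, q.eval (μ j) * (φ j u * φ j x) := by
  have heig : ∀ j, A *ᵥ ⇑(hA.eigenvectorBasis j) =
      hA.eigenvalues j • ⇑(hA.eigenvectorBasis j) := hA.mulVec_eigenvectorBasis
  refine ⟨hA.eigenvalues, fun j => ⇑(hA.eigenvectorBasis j),
    hA.spectrum_real_eq_range_eigenvalues, heig, fun j hj => ?_, fun q x u => ?_⟩
  · refine hA.eigenvectorBasis.orthonormal.ne_zero j ?_
    ext x
    exact congrFun hj x
  · have hu : (Pi.single u 1 : V → ℝ) =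
        ∑ j, hA.eigenvectorBasis j u • ⇑(hA.eigenvectorBasis j) := by
      have := hA.eigenvectorBasis.sum_repr' (EuclideanSpace.single u (1 : ℝ))
      ext y
      have h2 := congrArg (fun z : EuclideanSpace ℝ V => z y) this
      simp only [EuclideanSpace.inner_single_right] at h2
      simpa [Pi.single_apply] using h2.symm
    have h1 : aeval A q x u = (aeval A q *ᵥ Pi.single u 1) x := by
      rw [mulVec_single_one]; rfl
    rw [h1, hu, mulVec_sum, Finset.sum_apply]
    refine Finset.sum_congr rfl fun j _ => ?_
    rw [mulVec_smul, aeval_mulVec_of_mulVec_eq_smul (heig j)]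
    simp only [Pi.smul_apply, smul_eq_mul]
    ring

theorem mem_span_of_degree_lt {p : ℕ → ℝ[X]} {n : ℕ}
    (hp : ∀ i < n, (p i).degree = (i : WithBot ℕ)) (q : ℝ[X]) (hq : q.degree < (n : WithBot ℕ)) :
    ∃ c : ℕ → ℝ, q = ∑ i ∈ Finset.range n, C (c i) * p i := by
  induction n generalizing q with
  | zero =>
    refine ⟨0, ?_⟩
    rw [Nat.cast_zero, Nat.WithBot.lt_zero_iff, degree_eq_bot] at hq
    simp [hq]
  | succ n ih =>
    have hpn := hp n n.lt_succ_self
    have hlead : (p n).coeff n ≠ 0 := coeff_ne_zero_of_eq_degree hpn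
    obtain ⟨c, hc⟩ := ih (fun i hi => hp i (hi.trans n.lt_succ_self))
      (q - C (q.coeff n / (p n).coeff n) * p n) (by
        rw [degree_lt_iff_coeff_zero]
        intro m hm
        rcases hm.eq_or_lt with rfl | hm
        · simp [hlead]
        · have h1 : q.coeff m = 0 := (degree_lt_iff_coeff_zero _ _).1 hq m hm
          have h2 : (p n).coeff m = 0 := coeff_eq_zero_of_degree_lt (by
            rw [hpn]; exact_mod_cast hm)
          simp [h1, h2])
    refine ⟨fun i => if i = n then q.coeff n / (p n).coeff n else c i, ?_⟩
    rw [Finset.sum_range_succ, ← sub_eq_iff_eq_add]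
    simp only [if_true]
    rw [hc]
    refine Finset.sum_congr rfl fun i hi => ?_
    rw [if_neg (Finset.mem_range.1 hi).ne]

theorem exists_annihilator {A : Matrix V V ℝ} (hA : A.IsHermitian) (u : V) {n : ℕ}
    (hn : (eSupport A u).ncard = n + 1) :
    ∃ m : ℝ[X], m.Monic ∧ m.degree = ((n + 1 : ℕ) : WithBot ℕ) ∧ ∀ x, aeval A m x u = 0 := by
  obtain ⟨μ, φ, -, heig, -, hdec⟩ := hA.exists_eigen_decomposition
  have hfin : (eSupport A u).Finite := Set.finite_of_ncard_pos (by omega)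
  refine ⟨∏ θ ∈ hfin.toFinset, (X - C θ), monic_prod_of_monic _ _ fun θ _ => monic_X_sub_C θ,
    ?_, fun x => ?_⟩
  · rw [degree_prod]
    simp [← Set.ncard_eq_toFinset_card _ hfin, hn]
  · rw [hdec]
    refine Finset.sum_eq_zero fun j _ => ?_
    by_cases h : φ j u = 0
    · simp [h]
    · rw [eval_prod, Finset.prod_eq_zero (i := μ j), zero_mul]
      · exact hfin.mem_toFinset.2 ⟨φ j, heig j, h⟩
      · simp

omit [DecidableEq V] in
/-- The indicator of `θ` on a finite family of reals is a polynomial function. -/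
theorem exists_idempotent_polynomial (μ : V → ℝ) (θ : ℝ) :
    ∃ q : ℝ[X], ∀ j, q.eval (μ j) = if μ j = θ then 1 else 0 := by
  refine ⟨Lagrange.interpolate (Finset.univ.image μ) id (fun x => if x = θ then 1 else 0),
    fun j => ?_⟩
  exact Lagrange.eval_interpolate_at_node (v := id) _ (Function.injective_id.injOn)
    (Finset.mem_image_of_mem μ (Finset.mem_univ j))

theorem eSupport_subset_spectrum (A : Matrix V V ℝ) (u : V) : eSupport A u ⊆ spectrum ℝ A := by
  rintro θ ⟨w, hw, hwu⟩
  rw [← spectrum_toLin', ← Module.End.hasEigenvalue_iff_mem_spectrum]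
  refine Module.End.hasEigenvalue_of_hasEigenvector (x := w)
    ⟨Module.End.mem_eigenspace_iff.2 (by rw [toLin'_apply, hw]), ?_⟩
  rintro rfl
  exact hwu rfl

end SpectralDecomposition

section PseudoDistanceRegular

variable {V : Type*} [Fintype V] [DecidableEq V] {G : SimpleGraph V} [DecidableRel G.Adj]

omit [Fintype V] [DecidableEq V] in
theorem isHermitian_adjMatrix_real : (G.adjMatrix ℝ).IsHermitian := by
  rw [Matrix.IsHermitian, conjTranspose_eq_transpose_of_trivial]
  exact G.transpose_adjMatrix

theorem aeval_adjMatrix_symm (q : ℝ[X]) (x u : V) :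
    aeval (G.adjMatrix ℝ) q x u = aeval (G.adjMatrix ℝ) q u x := by
  obtain ⟨μ, φ, -, -, -, hdec⟩ := (isHermitian_adjMatrix_real (G := G)).exists_eigen_decomposition
  rw [hdec, hdec]
  exact Finset.sum_congr rfl fun j _ => by ring

theorem aeval_adjMatrix_apply_eq_zero {q : ℝ[X]} {u w : V}
    (h : q.degree < (G.dist u w : WithBot ℕ)) : aeval (G.adjMatrix ℝ) q w u = 0 := by
  rw [aeval_adjMatrix_symm, aeval_eq_sum_range, Matrix.sum_apply]
  refine Finset.sum_eq_zero fun k hk => ?_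
  by_cases hc : q.coeff k = 0
  · simp [hc]
  have hk : k < G.dist u w := by
    have := lt_of_le_of_lt (le_degree_of_ne_zero hc) h
    exact_mod_cast this
  rw [Matrix.smul_apply, SimpleGraph.adjMatrix_pow_apply_eq_card_walk]
  have : IsEmpty {p : G.Walk u w | p.length = k} :=
    ⟨fun p => by have h1 := SimpleGraph.dist_le p.1; have h2 : p.1.length = k := p.2; omega⟩
  simp

theorem aeval_mul_apply_self (p q : ℝ[X]) (u : V) :
    aeval (G.adjMatrix ℝ) (p * q) u u =
      ∑ x, aeval (G.adjMatrix ℝ) p x u * aeval (G.adjMatrix ℝ) q x u := by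
  rw [map_mul, Matrix.mul_apply]
  exact Finset.sum_congr rfl fun x _ => by rw [aeval_adjMatrix_symm p u x]

omit [DecidableEq V] [DecidableRel G.Adj] in
theorem SimpleGraph.Connected.exists_isEcc (hconn : G.Connected) (u : V) : ∃ e, IsEcc G u e := by
  have := hconn.nonempty
  obtain ⟨v, hv⟩ := Finite.exists_max (G.dist u)
  exact ⟨_, hv, v, rfl⟩

omit [Fintype V] [DecidableEq V] [DecidableRel G.Adj] in
theorem SimpleGraph.Connected.eq_of_forall_adj {α : Type*} (hconn : G.Connected) {f : V → α}
    (h : ∀ u v, G.Adj u v → f u = f v) (u v : V) : f u = f v := by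
  obtain ⟨p⟩ := hconn.preconnected u v
  induction p with
  | nil => rfl
  | cons hadj _ ih => exact (h _ _ hadj).trans ih

/-- The polynomials of a pseudo-distance-regular vertex span its cyclic subspace. -/
theorem IsPseudoDistRegular.exists_expansion {u : V} {e : ℕ}
    (h : IsPseudoDistRegular G (G.adjMatrix ℝ) u e) (he : IsEcc G u e) :
    ∃ p : ℕ → ℝ[X], (∀ i ≤ e, (p i).degree = (i : WithBot ℕ)) ∧
      (∀ i ≤ e, ∀ w, aeval (G.adjMatrix ℝ) (p i) w u ≠ 0 ↔ G.dist u w = i) ∧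
      ∀ q : ℝ[X], ∃ c : ℕ → ℝ, ∀ w, aeval (G.adjMatrix ℝ) q w u =
        c (G.dist u w) * aeval (G.adjMatrix ℝ) (p (G.dist u w)) w u := by
  obtain ⟨hcard, hp⟩ := h
  obtain ⟨m, hmonic, hmdeg, hm⟩ := exists_annihilator isHermitian_adjMatrix_real u hcard
  choose! p hdeg hsupp using hp
  simp only [mulVec_single_one, Matrix.col_apply] at hsupp
  refine ⟨p, hdeg, hsupp, fun q => ?_⟩
  obtain ⟨c, hc⟩ := mem_span_of_degree_lt (p := p) (n := e + 1)
    (fun i hi => hdeg i (Nat.lt_succ_iff.1 hi)) (q %ₘ m) (by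
      rw [← hmdeg]
      exact degree_modByMonic_lt q hmonic)
  refine ⟨c, fun w => ?_⟩
  have hred : aeval (G.adjMatrix ℝ) q w u = aeval (G.adjMatrix ℝ) (q %ₘ m) w u := by
    conv_lhs => rw [← modByMonic_add_div q m]
    rw [mul_comm, map_add, map_mul, Matrix.add_apply, Matrix.mul_apply]
    simp [hm]
  rw [hred, hc, map_sum, Matrix.sum_apply, Finset.sum_eq_single (G.dist u w)]
  · simp [C_mul']
  · intro i hi hne
    have : aeval (G.adjMatrix ℝ) (p i) w u = 0 := by
      by_contra h0
      exact hne ((hsupp i (Nat.lt_succ_iff.1 (Finset.mem_range.1 hi)) w).1 h0).symm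
    simp [C_mul', this]
  · intro hi
    exact absurd (Finset.mem_range.2 (Nat.lt_succ_of_le (he.1 w))) hi

variable (hconn : G.Connected)
  (hpdr : ∀ (u : V) (e : ℕ), IsEcc G u e → IsPseudoDistRegular G (G.adjMatrix ℝ) u e)
include hconn hpdr

theorem aeval_apply_eq_of_adj {u w w' : V} (hw : G.Adj u w) (hw' : G.Adj u w') (q : ℝ[X]) :
    aeval (G.adjMatrix ℝ) q w u = aeval (G.adjMatrix ℝ) q w' u := by
  obtain ⟨e, he⟩ := hconn.exists_isEcc u
  obtain ⟨p, hdeg, -, hexp⟩ := (hpdr u e he).exists_expansion he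
  obtain ⟨c, hc⟩ := hexp q
  have hd := SimpleGraph.dist_eq_one_iff_adj.2 hw
  have hd' := SimpleGraph.dist_eq_one_iff_adj.2 hw'
  have h1 : (p 1).natDegree ≤ 1 :=
    natDegree_le_of_degree_le (hdeg 1 (hd ▸ he.1 w)).le
  obtain ⟨a, b, hab⟩ := exists_eq_X_add_C_of_natDegree_le_one h1
  have key : ∀ x, G.Adj u x → aeval (G.adjMatrix ℝ) (p 1) x u = a := by
    intro x hx
    rw [hab]
    simp [Algebra.algebraMap_eq_smul_one, hx.symm, hx.ne', C_mul']
  rw [hc, hc, hd, hd', key w hw, key w' hw']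

theorem aeval_X_mul_apply_self {u w : V} (hw : G.Adj u w) (q : ℝ[X]) :
    aeval (G.adjMatrix ℝ) (X * q) u u = G.degree u * aeval (G.adjMatrix ℝ) q w u := by
  rw [map_mul, aeval_X, SimpleGraph.adjMatrix_mul_apply,
    Finset.sum_congr rfl fun x hx => aeval_apply_eq_of_adj hconn hpdr
      ((G.mem_neighborFinset u x).1 hx) hw q]
  simp

theorem aeval_X_mul_apply_self_div_degree (hdeg : ∀ u, 0 < G.degree u) (q : ℝ[X]) (u v : V) :
    aeval (G.adjMatrix ℝ) (X * q) u u / G.degree u =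
      aeval (G.adjMatrix ℝ) (X * q) v v / G.degree v := by
  refine hconn.eq_of_forall_adj (f := fun u => aeval (G.adjMatrix ℝ) (X * q) u u / G.degree u)
    (fun u w h => ?_) u v
  have hu : (G.degree u : ℝ) ≠ 0 := by exact_mod_cast (hdeg u).ne'
  have hw : (G.degree w : ℝ) ≠ 0 := by exact_mod_cast (hdeg w).ne'
  change aeval (G.adjMatrix ℝ) (X * q) u u / G.degree u =
    aeval (G.adjMatrix ℝ) (X * q) w w / G.degree w
  rw [aeval_X_mul_apply_self hconn hpdr h, aeval_X_mul_apply_self hconn hpdr h.symm,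
    aeval_adjMatrix_symm q u w]
  field_simp

/-- The spectral idempotent of the largest eigenvalue. -/
theorem exists_perron_idempotent (hdeg : ∀ u, 0 < G.degree u) :
    ∃ (E : ℝ[X]) (m θ : ℝ), 0 < m ∧ (∀ u w, G.Adj u w → √(G.degree u) * √(G.degree w) = θ) ∧
      ∀ x u, aeval (G.adjMatrix ℝ) E x u = m * √(G.degree u) * √(G.degree x) := by
  obtain ⟨μ, φ, -, -, hφ, hdec⟩ := (isHermitian_adjMatrix_real (G := G)).exists_eigen_decomposition
  have := hconn.nonempty
  obtain ⟨j₀, hj₀⟩ := Finite.exists_max μ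
  set θ := μ j₀ with hθ
  set s : V → ℝ := fun u => √(G.degree u) with hs
  have hspos : ∀ u, 0 < s u := fun u => Real.sqrt_pos.2 (by exact_mod_cast hdeg u)
  have hsq : ∀ u, s u * s u = G.degree u := fun u => Real.mul_self_sqrt (Nat.cast_nonneg _)
  obtain ⟨E, hE⟩ := exists_idempotent_polynomial μ θ
  have hdecE : ∀ x u, aeval (G.adjMatrix ℝ) E x u =
      ∑ j, (if μ j = θ then 1 else 0) * (φ j u * φ j x) := fun x u => by
    rw [hdec]
    exact Finset.sum_congr rfl fun j _ => by rw [hE]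
  -- Rayleigh quotient of `s`
  have hray : ∑ u, ∑ w, G.adjMatrix ℝ u w * (s u * s w) ≤ θ * ∑ u, s u * s u := by
    have hA : ∀ u w, G.adjMatrix ℝ u w = ∑ j, μ j * (φ j w * φ j u) := fun u w => by
      simpa using hdec X u w
    have hI : ∀ u w, (1 : Matrix V V ℝ) u w = ∑ j, (φ j w * φ j u) := fun u w => by
      simpa using hdec 1 u w
    have h1 : ∑ u, ∑ w, G.adjMatrix ℝ u w * (s u * s w) =
        ∑ j, μ j * (∑ u, φ j u * s u) ^ 2 := by
      simp_rw [hA, Finset.sum_mul, pow_two, Finset.sum_mul_sum, Finset.mul_sum]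
      rw [Finset.sum_congr rfl fun u _ => Finset.sum_comm, Finset.sum_comm]
      refine Finset.sum_congr rfl fun j _ => Finset.sum_congr rfl fun u _ =>
        Finset.sum_congr rfl fun w _ => by ring
    have h2 : ∑ u, s u * s u = ∑ j, (∑ u, φ j u * s u) ^ 2 := by
      have h3 : ∑ u, s u * s u = ∑ u, ∑ w, (1 : Matrix V V ℝ) u w * (s u * s w) := by
        simp [Matrix.one_apply]
      rw [h3]
      simp_rw [hI, Finset.sum_mul, pow_two, Finset.sum_mul_sum]
      rw [Finset.sum_congr rfl fun u _ => Finset.sum_comm, Finset.sum_comm]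
      refine Finset.sum_congr rfl fun j _ => Finset.sum_congr rfl fun u _ =>
        Finset.sum_congr rfl fun w _ => by ring
    rw [h1, h2, Finset.mul_sum]
    exact Finset.sum_le_sum fun j _ => mul_le_mul_of_nonneg_right (hj₀ j) (sq_nonneg _)
  have hdegsum : ∀ u, s u * s u = ∑ w, G.adjMatrix ℝ u w := fun u => by
    
    rw [hsq]
    simp [SimpleGraph.adjMatrix_apply, ← SimpleGraph.card_neighborFinset_eq_degree,
      SimpleGraph.neighborFinset_eq_filter]
  have hθpos : 0 < θ := by
    obtain ⟨u⟩ := this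
    have hpos : 0 < ∑ u, ∑ w, G.adjMatrix ℝ u w * (s u * s w) := by
      obtain ⟨w, hw⟩ := (G.degree_pos_iff_exists_adj u).1 (hdeg u)
      have hnn : ∀ u w, 0 ≤ G.adjMatrix ℝ u w * (s u * s w) := fun u w =>
        mul_nonneg (by rw [SimpleGraph.adjMatrix_apply]; split_ifs <;> norm_num)
          (mul_pos (hspos u) (hspos w)).le
      refine Finset.sum_pos' (fun u _ => Finset.sum_nonneg fun w _ => hnn u w)
        ⟨u, Finset.mem_univ u, Finset.sum_pos' (fun w _ => hnn u w) ⟨w, Finset.mem_univ w, ?_⟩⟩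
      rw [SimpleGraph.adjMatrix_apply, if_pos hw]
      have := mul_pos (hspos u) (hspos w)
      linarith
    have h2 : 0 ≤ ∑ u, s u * s u := Finset.sum_nonneg fun u _ => mul_self_nonneg _
    by_contra hcon
    have := mul_nonneg (neg_nonneg.2 (not_lt.1 hcon)) h2
    linarith
  -- closed walks
  have hXE : ∀ x u, aeval (G.adjMatrix ℝ) (X * E) x u = θ * aeval (G.adjMatrix ℝ) E x u := by
    intro x u
    rw [hdec, hdec, Finset.mul_sum]
    refine Finset.sum_congr rfl fun j _ => ?_
    rw [eval_mul, eval_X, hE]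
    split_ifs with h
    · rw [h]; ring
    · ring
  have hEE : ∀ x u, aeval (G.adjMatrix ℝ) (E * E) x u = aeval (G.adjMatrix ℝ) E x u := by
    intro x u
    rw [hdec, hdec]
    refine Finset.sum_congr rfl fun j _ => ?_
    rw [eval_mul, hE]
    split_ifs <;> ring
  obtain ⟨x₀, hx₀⟩ := Function.ne_iff.1 (hφ j₀)
  set m := aeval (G.adjMatrix ℝ) E x₀ x₀ / G.degree x₀ with hm
  have hmpos : 0 < m := by
    refine div_pos ?_ (by exact_mod_cast hdeg x₀)
    rw [hdecE]
    refine Finset.sum_pos' (fun j _ => ?_) ⟨j₀, Finset.mem_univ _, ?_⟩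
    · split_ifs
      · rw [one_mul]; exact mul_self_nonneg _
      · simp
    · rw [if_pos rfl, one_mul]
      exact mul_self_pos.2 hx₀
  have hdiag : ∀ u, aeval (G.adjMatrix ℝ) E u u = m * (s u * s u) := by
    intro u
    have h := aeval_X_mul_apply_self_div_degree hconn hpdr hdeg E u x₀
    rw [hXE, hXE, mul_div_assoc, mul_div_assoc, ← hm] at h
    have h := mul_left_cancel₀ hθpos.ne' h
    have hu : (G.degree u : ℝ) ≠ 0 := by exact_mod_cast (hdeg u).ne'
    rw [hsq, ← h]
    field_simp
  have hoff : ∀ u w, G.Adj u w → aeval (G.adjMatrix ℝ) E w u = θ * m := by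
    intro u w h
    have h1 := aeval_X_mul_apply_self hconn hpdr h E
    have hu : (G.degree u : ℝ) ≠ 0 := by exact_mod_cast (hdeg u).ne'
    rw [hXE, hdiag, hsq] at h1
    refine mul_left_cancel₀ hu ?_
    rw [← h1]
    ring
  have hnorm : ∀ u w, G.Adj u w → ∑ x, (s w * aeval (G.adjMatrix ℝ) E x u -
      s u * aeval (G.adjMatrix ℝ) E x w) ^ 2 = 2 * m * (s u * s w) * (s u * s w - θ) := by
    intro u w h
    have h1 : ∀ a b, ∑ x, aeval (G.adjMatrix ℝ) E x a * aeval (G.adjMatrix ℝ) E x b =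
        aeval (G.adjMatrix ℝ) E a b := by
      intro a b
      rw [← hEE a b, map_mul, Matrix.mul_apply]
      exact Finset.sum_congr rfl fun x _ => by rw [aeval_adjMatrix_symm E a x]
    have h2 : ∀ x, (s w * aeval (G.adjMatrix ℝ) E x u - s u * aeval (G.adjMatrix ℝ) E x w) ^ 2 =
        s w * s w * (aeval (G.adjMatrix ℝ) E x u * aeval (G.adjMatrix ℝ) E x u) +
        s u * s u * (aeval (G.adjMatrix ℝ) E x w * aeval (G.adjMatrix ℝ) E x w) -
        2 * (s u * s w) * (aeval (G.adjMatrix ℝ) E x w * aeval (G.adjMatrix ℝ) E x u) :=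
      fun x => by ring
    simp_rw [h2]
    rw [Finset.sum_sub_distrib, Finset.sum_add_distrib, ← Finset.mul_sum, ← Finset.mul_sum,
      ← Finset.mul_sum, h1, h1, h1, hdiag, hdiag, hoff u w h]
    ring
  have hge : ∀ u w, G.Adj u w → θ ≤ s u * s w := by
    intro u w h
    have h1 : 0 ≤ 2 * m * (s u * s w) * (s u * s w - θ) := by
      rw [← hnorm u w h]
      exact Finset.sum_nonneg fun x _ => sq_nonneg _
    have h2 : 0 < 2 * m * (s u * s w) := by
      have := mul_pos (hspos u) (hspos w)
      positivity
    have := nonneg_of_mul_nonneg_right h1 h2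
    linarith
  have hedge : ∀ u w, G.Adj u w → s u * s w = θ := by
    have hnn : ∀ u w, 0 ≤ G.adjMatrix ℝ u w * (s u * s w - θ) := by
      intro u w
      rw [SimpleGraph.adjMatrix_apply]
      split_ifs with h
      · linarith [hge u w h]
      · simp
    have hle : ∑ u, ∑ w, G.adjMatrix ℝ u w * (s u * s w - θ) ≤ 0 := by
      simp_rw [mul_sub, Finset.sum_sub_distrib, ← Finset.sum_mul]
      simp_rw [hdegsum] at hray
      linarith
    have h0 := le_antisymm hle (Finset.sum_nonneg fun u _ => Finset.sum_nonneg fun w _ => hnn u w)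
    intro u w h
    have h1 := (Finset.sum_eq_zero_iff_of_nonneg
      fun u _ => Finset.sum_nonneg fun w _ => hnn u w).1 h0 u (Finset.mem_univ u)
    have h2 := (Finset.sum_eq_zero_iff_of_nonneg fun w _ => hnn u w).1 h1 w (Finset.mem_univ w)
    rw [SimpleGraph.adjMatrix_apply, if_pos h] at h2
    linarith
  refine ⟨E, m, θ, hmpos, hedge, fun x u => ?_⟩
  have hcol : ∀ u w, aeval (G.adjMatrix ℝ) E x u / s u = aeval (G.adjMatrix ℝ) E x w / s w := by
    refine hconn.eq_of_forall_adj (f := fun u => aeval (G.adjMatrix ℝ) E x u / s u)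
      fun u w h => ?_
    have h0 := hnorm u w h
    rw [hedge u w h, sub_self, mul_zero] at h0
    have h1 := (Finset.sum_eq_zero_iff_of_nonneg fun x _ => sq_nonneg _).1 h0 x (Finset.mem_univ x)
    have h2 := pow_eq_zero_iff (two_ne_zero) |>.1 h1
    rw [div_eq_div_iff (hspos u).ne' (hspos w).ne']
    linarith
  have h1 := hcol u x
  rw [hdiag x, ← mul_assoc, mul_div_assoc, div_self (hspos x).ne', mul_one,
    div_eq_iff (hspos u).ne'] at h1
  rw [h1]
  change m * s x * s u = m * s u * s x
  ring

omit [DecidableRel G.Adj] [Fintype V] hpdr in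
theorem IsBipartition.even_dist_iff {B C : Finset V} (hbip : IsBipartition G B C) (u v : V) :
    Even (G.dist u v) ↔ (u ∈ B ↔ v ∈ B) := by
  obtain ⟨p, hp⟩ := hconn.exists_walk_length_eq_dist u v
  let c : G.Coloring Bool := SimpleGraph.Coloring.mk (fun v => decide (v ∈ B)) (by
    intro u v h
    have h1 := hbip.2.1 u
    have h2 := hbip.2.1 v
    rcases hbip.2.2 u v h with ⟨hu, hv⟩ | ⟨hu, hv⟩
    · simp_all
    · simp_all)
  have h := c.even_length_iff_congr p
  change Even p.length ↔ (decide (u ∈ B) = true ↔ decide (v ∈ B) = true) at h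
  simpa [hp] using h

omit [DecidableRel G.Adj] [Fintype V] [DecidableEq V] hpdr in
theorem SimpleGraph.Connected.exists_dist_eq_of_le {u v : V} {i : ℕ} (hi : i ≤ G.dist u v) :
    ∃ x, G.dist u x = i := by
  obtain ⟨p, hp⟩ := hconn.exists_walk_length_eq_dist u v
  refine ⟨p.getVert i, ?_⟩
  have h1 := SimpleGraph.dist_le (p.take i)
  have h2 := SimpleGraph.dist_le (p.drop i)
  have h3 := hconn.dist_triangle (u := u) (v := p.getVert i) (w := v)
  rw [SimpleGraph.Walk.take_length] at h1
  rw [SimpleGraph.Walk.drop_length] at h2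
  omega

variable {B C : Finset V} (hbip : IsBipartition G B C) (hdeg : ∀ u, 0 < G.degree u)
include hbip hdeg

/-- A positive eigenvector that is constant on both sides of the bipartition. -/
theorem exists_bipartite_perron_vector :
    ∃ (E : ℝ[X]) (m : ℝ) (s : V → ℝ), 0 < m ∧ (∀ u, 0 < s u) ∧
      (∀ u v, (u ∈ B ↔ v ∈ B) → s u = s v ∧ G.degree u = G.degree v) ∧
      ∀ x u, aeval (G.adjMatrix ℝ) E x u = m * s u * s x := by
  obtain ⟨E, m, θ, hm, hedge, hE⟩ := exists_perron_idempotent hconn hpdr hdeg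
  have hspos : ∀ u, 0 < √(G.degree u : ℝ) := fun u =>
    Real.sqrt_pos.2 (by exact_mod_cast hdeg u)
  have hside : ∀ u v, (u ∈ B ↔ v ∈ B) → √(G.degree u : ℝ) = √(G.degree v : ℝ) := by
    intro u v huv
    have hθ : θ ≠ 0 := by
      obtain ⟨w, hw⟩ := (G.degree_pos_iff_exists_adj u).1 (hdeg u)
      rw [← hedge u w hw]
      exact (mul_pos (hspos u) (hspos w)).ne'
    have h := hconn.eq_of_forall_adj
      (f := fun u => if u ∈ B then √(G.degree u : ℝ) else θ / √(G.degree u : ℝ)) (fun u w h => by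
        have h1 := hbip.2.1 u
        have h2 := hbip.2.1 w
        have h3 := hedge u w h
        have h4 := hspos u
        have h5 := hspos w
        rcases hbip.2.2 u w h with ⟨hu, hw⟩ | ⟨hu, hw⟩
        · have hw' : w ∉ B := fun hb => h2 ⟨hb, hw⟩
          simp only [hu, hw', if_true, if_false]
          rw [eq_div_iff h5.ne', h3]
        · have hu' : u ∉ B := fun hb => h1 ⟨hb, hu⟩
          simp only [hw, hu', if_true, if_false]
          rw [div_eq_iff h4.ne', ← h3, mul_comm]) u v
    by_cases hu : u ∈ B
    · simpa [hu, huv.1 hu] using h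
    · have hv : v ∉ B := fun hv => hu (huv.2 hv)
      simp only [hu, hv, if_false] at h
      rw [div_eq_div_iff (hspos u).ne' (hspos v).ne'] at h
      exact (mul_left_cancel₀ hθ h).symm
  refine ⟨E, m, fun u => √(G.degree u : ℝ), hm, hspos, fun u v huv => ⟨hside u v huv, ?_⟩, hE⟩
  have := (Real.sqrt_inj (Nat.cast_nonneg _) (Nat.cast_nonneg _)).1 (hside u v huv)
  exact_mod_cast this

/-- Closed walk counts agree at vertices on the same side. -/
theorem aeval_apply_self_eq_of_side {u v : V} (huv : u ∈ B ↔ v ∈ B) (q : ℝ[X]) :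
    aeval (G.adjMatrix ℝ) q u u = aeval (G.adjMatrix ℝ) q v v := by
  obtain ⟨_, _, _, _, _, hside, _⟩ := exists_bipartite_perron_vector hconn hpdr hbip hdeg
  have h := aeval_X_mul_apply_self_div_degree hconn hpdr hdeg q.divX u v
  have hv : (G.degree v : ℝ) ≠ 0 := by exact_mod_cast (hdeg v).ne'
  rw [(hside u v huv).2, div_left_inj' hv] at h
  have key : ∀ x, aeval (G.adjMatrix ℝ) q x x =
      aeval (G.adjMatrix ℝ) (X * q.divX) x x + q.coeff 0 := by
    intro x
    conv_lhs => rw [← divX_mul_X_add q, mul_comm q.divX, map_add, Matrix.add_apply, aeval_C,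
      Algebra.algebraMap_eq_smul_one, Matrix.smul_apply, Matrix.one_apply_eq, smul_eq_mul, mul_one]
  rw [key, key, h]

theorem sum_mul_eq_of_side {u v : V} (huv : u ∈ B ↔ v ∈ B) (p q : ℝ[X]) :
    ∑ x, aeval (G.adjMatrix ℝ) p x u * aeval (G.adjMatrix ℝ) q x u =
      ∑ x, aeval (G.adjMatrix ℝ) p x v * aeval (G.adjMatrix ℝ) q x v := by
  rw [← aeval_mul_apply_self, ← aeval_mul_apply_self,
    aeval_apply_self_eq_of_side hconn hpdr hbip hdeg huv]

theorem aeval_apply_eq_of_dist_eq {u x x' : V} (h : G.dist u x = G.dist u x') (q : ℝ[X]) :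
    aeval (G.adjMatrix ℝ) q x u = aeval (G.adjMatrix ℝ) q x' u := by
  obtain ⟨E, m, s, hm, hspos, hside, hE⟩ := exists_bipartite_perron_vector hconn hpdr hbip hdeg
  obtain ⟨e, he⟩ := hconn.exists_isEcc u
  obtain ⟨p, -, -, hexp⟩ := (hpdr u e he).exists_expansion he
  obtain ⟨c, hc⟩ := hexp E
  obtain ⟨c', hc'⟩ := hexp q
  have hs : s x = s x' := by
    refine (hside x x' ?_).1
    have h1 := hbip.even_dist_iff hconn u x
    have h2 := hbip.even_dist_iff hconn u x'
    rw [h] at h1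
    tauto
  have h1 := hc x
  have h2 := hc x'
  rw [hE, h] at h1
  rw [hE, ← hs, h1] at h2
  have hne : c (G.dist u x') ≠ 0 := by
    rintro h0
    rw [h0, zero_mul] at h1
    exact (mul_pos (mul_pos hm (hspos u)) (hspos x)).ne' h1
  rw [hc', hc', h, mul_left_cancel₀ hne h2]

omit [DecidableRel G.Adj] [Fintype V] [DecidableEq V] hconn hpdr hbip hdeg in
theorem IsEcc.exists_dist_eq (hconn : G.Connected) {u : V} {e i : ℕ} (he : IsEcc G u e)
    (hi : i ≤ e) : ∃ x, G.dist u x = i := by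
  obtain ⟨v, hv⟩ := he.2
  exact hconn.exists_dist_eq_of_le (v := v) (by omega)

theorem exists_distance_polynomial {u : V} {e i : ℕ} (he : IsEcc G u e) (hi : i ≤ e) :
    ∃ P : ℝ[X], P.degree = (i : WithBot ℕ) ∧
      ∀ x, aeval (G.adjMatrix ℝ) P x u = if G.dist u x = i then 1 else 0 := by
  obtain ⟨p, hdegp, hsupp, -⟩ := (hpdr u e he).exists_expansion he
  obtain ⟨x₀, hx₀⟩ := he.exists_dist_eq hconn hi
  have hne := (hsupp i hi x₀).2 hx₀
  refine ⟨Polynomial.C (aeval (G.adjMatrix ℝ) (p i) x₀ u)⁻¹ * p i, ?_, fun x => ?_⟩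
  · rw [degree_C_mul (inv_ne_zero hne), hdegp i hi]
  · rw [C_mul', map_smul, Matrix.smul_apply, smul_eq_mul]
    split_ifs with h
    · rw [aeval_apply_eq_of_dist_eq hconn hpdr hbip hdeg (h.trans hx₀.symm), inv_mul_cancel₀ hne]
    · rw [not_not.1 (mt (hsupp i hi x).1 h), mul_zero]

/-- A distance polynomial of a vertex is a distance polynomial of every vertex on its side. -/
theorem distance_polynomial_of_side {u v : V} (huv : u ∈ B ↔ v ∈ B) {e i : ℕ} (he : IsEcc G u e)
    (hi : i ≤ e) {P : ℝ[X]} (hP : P.degree = (i : WithBot ℕ))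
    (hPu : ∀ x, aeval (G.adjMatrix ℝ) P x u = if G.dist u x = i then 1 else 0) :
    (∃ x, G.dist v x = i) ∧
      ∀ x, aeval (G.adjMatrix ℝ) P x v = if G.dist v x = i then 1 else 0 := by
  obtain ⟨E, m, s, hm, hspos, hside, hE⟩ := exists_bipartite_perron_vector hconn hpdr hbip hdeg
  obtain ⟨e', he'⟩ := hconn.exists_isEcc v
  obtain ⟨x₁, hx₁⟩ := he.exists_dist_eq hconn hi
  have hoff : ∀ x, G.dist v x ≠ i → aeval (G.adjMatrix ℝ) P x v = 0 := by
    intro x₀ hne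
    rcases lt_or_gt_of_ne hne with hlt | hgt
    · obtain ⟨Q, hQ, hQv⟩ := exists_distance_polynomial hconn hpdr hbip hdeg he' (he'.1 x₀)
      have h1 := sum_mul_eq_of_side hconn hpdr hbip hdeg huv Q P
      rw [Finset.sum_eq_zero fun x _ => ?_] at h1
      · simp_rw [hQv, ite_mul, one_mul, zero_mul, ← Finset.sum_filter] at h1
        rw [Finset.sum_congr rfl fun x hx => aeval_apply_eq_of_dist_eq hconn hpdr hbip hdeg
          (Finset.mem_filter.1 hx).2 P, Finset.sum_const, nsmul_eq_mul] at h1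
        refine (mul_eq_zero.1 h1.symm).resolve_left ?_
        refine Nat.cast_ne_zero.2 ?_
        exact Finset.card_ne_zero_of_mem (Finset.mem_filter.2 ⟨Finset.mem_univ x₀, rfl⟩)
      · rw [hPu]
        split_ifs with h
        · rw [aeval_adjMatrix_apply_eq_zero, zero_mul]
          rw [hQ, h]
          exact_mod_cast hlt
        · rw [mul_zero]
    · refine aeval_adjMatrix_apply_eq_zero ?_
      rw [hP]
      exact_mod_cast hgt
  obtain ⟨t, ht⟩ : ∃ t, ∀ x, aeval (G.adjMatrix ℝ) P x v = if G.dist v x = i then t else 0 := by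
    by_cases h : ∃ x₀, G.dist v x₀ = i
    · obtain ⟨x₀, hx₀⟩ := h
      refine ⟨aeval (G.adjMatrix ℝ) P x₀ v, fun x => ?_⟩
      split_ifs with hx
      · exact aeval_apply_eq_of_dist_eq hconn hpdr hbip hdeg (hx.trans hx₀.symm) P
      · exact hoff x hx
    · push Not at h
      exact ⟨0, fun x => by rw [hoff x (h x), ite_self]⟩
  set n := (Finset.univ.filter fun x => G.dist u x = i).card with hn
  set n' := (Finset.univ.filter fun x => G.dist v x = i).card with hn'
  have hn0 : (n : ℝ) ≠ 0 := by
    rw [Nat.cast_ne_zero]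
    exact Finset.card_ne_zero_of_mem (Finset.mem_filter.2 ⟨Finset.mem_univ x₁, hx₁⟩)
  have hnorm : (n : ℝ) = n' * (t * t) := by
    have h1 := sum_mul_eq_of_side hconn hpdr hbip hdeg huv P P
    simp_rw [hPu, ht, ite_mul, zero_mul, ← Finset.sum_filter] at h1
    rw [Finset.sum_congr rfl fun x hx => by rw [if_pos (Finset.mem_filter.1 hx).2],
      Finset.sum_congr (s₁ := Finset.univ.filter fun x => G.dist v x = i) rfl fun x hx => by
        rw [if_pos (Finset.mem_filter.1 hx).2], Finset.sum_const, Finset.sum_const] at h1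
    simpa using h1
  have hpair : (n : ℝ) = n' * t := by
    have h1 := sum_mul_eq_of_side hconn hpdr hbip hdeg huv P E
    have hsx : ∀ a, (u ∈ B ↔ a ∈ B) → ∀ x, G.dist a x = i → s x = s x₁ := by
      intro a ha x hx
      refine (hside x x₁ ?_).1
      have h2 := hbip.even_dist_iff hconn a x
      have h3 := hbip.even_dist_iff hconn u x₁
      rw [hx] at h2
      rw [hx₁] at h3
      tauto
    simp_rw [hPu, ht, hE, ite_mul, zero_mul, ← Finset.sum_filter] at h1
    rw [Finset.sum_congr rfl fun x hx => by rw [hsx u Iff.rfl x (Finset.mem_filter.1 hx).2],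
      Finset.sum_congr (s₁ := Finset.univ.filter fun x => G.dist v x = i) rfl fun x hx => by
        rw [hsx v huv x (Finset.mem_filter.1 hx).2], Finset.sum_const, Finset.sum_const,
      (hside u v huv).1, ← hn, ← hn', nsmul_eq_mul, nsmul_eq_mul] at h1
    have h2 := (mul_pos (mul_pos hm (hspos v)) (hspos x₁)).ne'
    refine mul_right_cancel₀ h2 ?_
    linear_combination h1
  have ht1 : t = 1 := by
    have h1 : (n : ℝ) * t = n * 1 := by linear_combination t * hpair - hnorm
    exact mul_left_cancel₀ hn0 h1
  refine ⟨?_, fun x => by rw [ht, ht1]⟩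
  have hn0' : n' ≠ 0 := by
    rintro h0
    rw [h0] at hpair
    simp at hpair
    exact hn0 (by exact_mod_cast hpair)
  obtain ⟨x, hx⟩ := Finset.card_ne_zero.1 hn0'
  exact ⟨x, (Finset.mem_filter.1 hx).2⟩

theorem isEcc_le_of_side {u v : V} (huv : u ∈ B ↔ v ∈ B) {e : ℕ} (he : IsEcc G u e) (x : V) :
    G.dist v x ≤ e := by
  obtain ⟨e', he'⟩ := hconn.exists_isEcc v
  refine (he'.1 x).trans ?_
  obtain ⟨P, hP, hPv⟩ := exists_distance_polynomial hconn hpdr hbip hdeg he' le_rfl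
  obtain ⟨y, hy⟩ := (distance_polynomial_of_side hconn hpdr hbip hdeg huv.symm he' le_rfl hP hPv).1
  exact hy ▸ he.1 y

theorem exists_side_distance_polynomial (u : V) (i : ℕ) :
    ∃ P : ℝ[X], P.degree = (i : WithBot ℕ) ∧ ∀ v, (u ∈ B ↔ v ∈ B) →
      ∀ x, aeval (G.adjMatrix ℝ) P x v = if G.dist v x = i then 1 else 0 := by
  obtain ⟨e, he⟩ := hconn.exists_isEcc u
  by_cases hi : i ≤ e
  · obtain ⟨P, hP, hPu⟩ := exists_distance_polynomial hconn hpdr hbip hdeg he hi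
    exact ⟨P, hP, fun v huv =>
      (distance_polynomial_of_side hconn hpdr hbip hdeg huv he hi hP hPu).2⟩
  · obtain ⟨m, -, hmdeg, hm⟩ :=
      exists_annihilator isHermitian_adjMatrix_real u (hpdr u e he).1
    refine ⟨X ^ (i - (e + 1)) * m, ?_, fun v huv x => ?_⟩
    · rw [degree_mul, degree_X_pow, hmdeg]
      norm_cast
      omega
    · have hne : G.dist v x ≠ i := by
        have := isEcc_le_of_side hconn hpdr hbip hdeg huv he x
        omega
      have hmv : ∀ y, aeval (G.adjMatrix ℝ) m y v = 0 := by
        intro y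
        have h := sum_mul_eq_of_side hconn hpdr hbip hdeg huv m m
        simp_rw [hm, mul_zero, Finset.sum_const_zero] at h
        exact mul_self_eq_zero.1 ((Finset.sum_eq_zero_iff_of_nonneg
          fun y _ => mul_self_nonneg _).1 h.symm y (Finset.mem_univ y))
      rw [if_neg hne, map_mul, Matrix.mul_apply]
      simp [hmv]

omit hpdr hdeg hconn [DecidableEq V] in
theorem IsBipartition.neg_mem_eSupport {u : V} {θ : ℝ}
    (h : θ ∈ eSupport (G.adjMatrix ℝ) u) : -θ ∈ eSupport (G.adjMatrix ℝ) u := by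
  classical
  obtain ⟨w, hw, hwu⟩ := h
  refine ⟨fun x => if x ∈ B then w x else - w x, ?_, by by_cases hu : u ∈ B <;> simp [hu, hwu]⟩
  ext x
  have hx := congrFun hw x
  rw [SimpleGraph.adjMatrix_mulVec_apply] at hx ⊢
  simp only [Pi.smul_apply, smul_eq_mul] at hx ⊢
  by_cases hxB : x ∈ B
  · rw [if_pos hxB, Finset.sum_congr rfl (g := fun y => - w y) fun y hy => ?_,
      Finset.sum_neg_distrib, hx, neg_mul]
    rw [if_neg]
    intro hyB
    have h1 := hbip.2.1 x
    have h2 := hbip.2.1 y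
    have h3 := hbip.2.2 x y ((G.mem_neighborFinset x y).1 hy)
    tauto
  · rw [if_neg hxB, Finset.sum_congr rfl (g := fun y => w y) fun y hy => ?_, hx, neg_mul_neg]
    rw [if_pos]
    have h3 := hbip.2.2 x y ((G.mem_neighborFinset x y).1 hy)
    tauto

omit hpdr hdeg hconn [DecidableEq V] in
theorem IsBipartition.even_ncard_eSupport_diff {u : V}
    (hfin : (eSupport (G.adjMatrix ℝ) u).Finite) :
    Even (eSupport (G.adjMatrix ℝ) u \ {0}).ncard := by
  set S := eSupport (G.adjMatrix ℝ) u
  have hneg : ∀ θ ∈ S, -θ ∈ S := fun θ hθ => hbip.neg_mem_eSupport hθ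
  have hunion : S \ {0} = (S ∩ Set.Ioi 0) ∪ (S ∩ Set.Iio 0) := by
    ext θ
    simp only [Set.mem_sdiff, Set.mem_singleton_iff, Set.mem_union, Set.mem_inter_iff, Set.mem_Ioi,
      Set.mem_Iio, ← and_or_left]
    rw [← ne_eq, ne_iff_lt_or_gt, or_comm]
  have himage : S ∩ Set.Iio 0 = (fun θ => -θ) '' (S ∩ Set.Ioi 0) := by
    ext θ
    constructor
    · rintro ⟨h1, h2⟩
      exact ⟨-θ, ⟨hneg θ h1, by simpa using h2⟩, neg_neg θ⟩
    · rintro ⟨η, ⟨h1, h2⟩, rfl⟩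
      exact ⟨hneg η h1, by simpa using h2⟩
  rw [hunion, Set.ncard_union_eq _ (hfin.subset Set.inter_subset_left)
    (hfin.subset Set.inter_subset_left), himage, Set.ncard_image_of_injective _ neg_injective]
  · exact ⟨_, rfl⟩
  · rw [Set.disjoint_left]
    rintro θ ⟨-, h1⟩ ⟨-, h2⟩
    exact lt_asymm (Set.mem_Ioi.1 h1) (Set.mem_Iio.1 h2)

theorem ncard_spectrum_adjMatrix {d : ℕ} (hd : IsDiam G d) :
    (spectrum ℝ (G.adjMatrix ℝ)).ncard = d + 1 := by
  obtain ⟨hle, u, v, huv⟩ := hd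
  have hu : IsEcc G u d := ⟨hle u, v, huv⟩
  have hv : IsEcc G v d := ⟨hle v, u, by rw [SimpleGraph.dist_comm, huv]⟩
  have hcard := (hpdr u d hu).1
  rw [← hcard]
  congr 1
  obtain ⟨μ, φ, hspec, heig, hφ, hdec⟩ :=
    (isHermitian_adjMatrix_real (G := G)).exists_eigen_decomposition
  refine Set.Subset.antisymm ?_ ?_
  · rw [hspec]
    rintro _ ⟨j₀, rfl⟩
    obtain ⟨E, hE⟩ := exists_idempotent_polynomial μ (μ j₀)
    have hmem : ∀ x, aeval (G.adjMatrix ℝ) E x x ≠ 0 → μ j₀ ∈ eSupport (G.adjMatrix ℝ) x := by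
      intro x hx
      rw [hdec] at hx
      obtain ⟨j, -, hj⟩ := Finset.exists_ne_zero_of_sum_ne_zero hx
      rw [hE] at hj
      split_ifs at hj with h
      · refine ⟨φ j, h ▸ heig j, fun h0 => hj ?_⟩
        rw [h0]; ring
      · exact absurd (zero_mul _) hj
    obtain ⟨x₀, hx₀⟩ := Function.ne_iff.1 (hφ j₀)
    have hEx₀ : aeval (G.adjMatrix ℝ) E x₀ x₀ ≠ 0 := by
      refine ne_of_gt ?_
      rw [hdec]
      refine Finset.sum_pos' (fun j _ => ?_) ⟨j₀, Finset.mem_univ _, ?_⟩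
      · rw [hE]
        split_ifs
        · rw [one_mul]; exact mul_self_nonneg _
        · simp
      · rw [hE, if_pos rfl, one_mul]
        exact mul_self_pos.2 hx₀
    by_cases hθ : μ j₀ = 0
    · by_contra hnot
      have hfin : ∀ x, IsEcc G x d → (eSupport (G.adjMatrix ℝ) x).Finite := fun x hx =>
        Set.finite_of_ncard_pos (by rw [(hpdr x d hx).1]; omega)
      have hodd : Even (d + 1) := by
        have := hbip.even_ncard_eSupport_diff (hfin u hu)
        rwa [Set.sdiff_singleton_eq_self (hθ ▸ hnot), hcard] at this
      have hnot' : μ j₀ ∉ eSupport (G.adjMatrix ℝ) v := by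
        intro hmem
        have := hbip.even_ncard_eSupport_diff (hfin v hv)
        rw [Set.ncard_sdiff_singleton_of_mem (hθ ▸ hmem), (hpdr v d hv).1] at this
        rw [Nat.add_sub_cancel] at this
        exact (Nat.even_add_one.1 hodd) this
      have h1 : ¬ (u ∈ B ↔ v ∈ B) := by
        rw [← hbip.even_dist_iff hconn, huv]
        exact Nat.even_add_one.1 hodd
      have h2 : (x₀ ∈ B ↔ u ∈ B) ∨ (x₀ ∈ B ↔ v ∈ B) := by tauto
      rcases h2 with h2 | h2
      · exact hnot (hmem u (aeval_apply_self_eq_of_side hconn hpdr hbip hdeg h2 E ▸ hEx₀))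
      · exact hnot' (hmem v (aeval_apply_self_eq_of_side hconn hpdr hbip hdeg h2 E ▸ hEx₀))
    · refine hmem u fun h0 => hEx₀ ?_
      have hXE : ∀ x, aeval (G.adjMatrix ℝ) (X * E) x x =
          μ j₀ * aeval (G.adjMatrix ℝ) E x x := by
        intro x
        rw [hdec, hdec, Finset.mul_sum]
        refine Finset.sum_congr rfl fun j _ => ?_
        rw [eval_mul, eval_X, hE]
        split_ifs with h
        · rw [h]; ring
        · ring
      have h := aeval_X_mul_apply_self_div_degree hconn hpdr hdeg E x₀ u
      have hx : (G.degree x₀ : ℝ) ≠ 0 := by exact_mod_cast (hdeg x₀).ne'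
      rw [hXE, hXE, h0, mul_zero, zero_div, div_eq_zero_iff] at h
      simpa [hθ, hx] using h
  · exact eSupport_subset_spectrum _ _

end PseudoDistanceRegular

/-- A connected bipartite graph that is pseudo-distance-regular at every vertex is
distance-biregular. -/
theorem bipartite_pseudo_distance_regular_everywhere
    {V : Type*} [Fintype V] [DecidableEq V] (G : SimpleGraph V) [DecidableRel G.Adj]
    (hconn : G.Connected) (B C : Finset V) (hbip : IsBipartition G B C)
    (hpdr : ∀ (u : V) (e : ℕ), IsEcc G u e → IsPseudoDistRegular G (G.adjMatrix ℝ) u e) :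
    ∃ d : ℕ, IsDiam G d ∧ IsDistBiregular G (G.adjMatrix ℝ) B C d := by
  have hne := hconn.nonempty
  obtain ⟨⟨u₀, v₀⟩, hmax⟩ := Finite.exists_max fun z : V × V => G.dist z.1 z.2
  have hdiam : IsDiam G (G.dist u₀ v₀) := ⟨fun u v => hmax (u, v), u₀, v₀, rfl⟩
  refine ⟨_, hdiam, ?_⟩
  rcases subsingleton_or_nontrivial V with hV | hV
  · have hd : ∀ u v : V, G.dist u v = 0 := fun u v => by
      rw [Subsingleton.elim u v, SimpleGraph.dist_self]
    rw [hd]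
    refine ⟨?_, fun i => X ^ i, fun i => X ^ i, fun i hi => ?_⟩
    · rw [← (hpdr u₀ 0 ⟨fun v => (hd u₀ v).le, u₀, hd u₀ u₀⟩).1]
      congr 1
      refine Set.Subset.antisymm (fun θ hθ => ?_) (eSupport_subset_spectrum _ _)
      rw [← spectrum_toLin', ← Module.End.hasEigenvalue_iff_mem_spectrum] at hθ
      obtain ⟨w, hw, hw0⟩ := hθ.exists_hasEigenvector
      refine ⟨w, by rw [← toLin'_apply, Module.End.mem_eigenspace_iff.1 hw], fun h0 => hw0 ?_⟩
      ext x
      rw [Subsingleton.elim x u₀, h0]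
      rfl
    · obtain rfl : i = 0 := Nat.le_zero.1 hi
      have h1 : distMatrix G 0 = (1 : Matrix V V ℝ) := by
        ext u v
        simp [distMatrix, hd, Matrix.one_apply, Subsingleton.elim u v]
      simp [h1]
  · have hdeg : ∀ u, 0 < G.degree u := fun u =>
      hconn.preconnected.degree_pos_of_nontrivial u
    refine ⟨ncard_spectrum_adjMatrix hconn hpdr hbip hdeg hdiam, ?_⟩
    have key : ∀ S : Finset V, (∀ u ∈ S, ∀ v ∈ S, (u ∈ B ↔ v ∈ B)) →
        ∃ P : ℕ → ℝ[X], ∀ i, (P i).degree = (i : WithBot ℕ) ∧ ∀ v ∈ S,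
          aeval (G.adjMatrix ℝ) (P i) *ᵥ Pi.single v 1 = distMatrix G i *ᵥ Pi.single v 1 := by
      intro S hS
      rcases S.eq_empty_or_nonempty with rfl | ⟨u, hu⟩
      · exact ⟨fun i => X ^ i, fun i => ⟨degree_X_pow i, by simp⟩⟩
      · choose P hP hPv using exists_side_distance_polynomial hconn hpdr hbip hdeg u
        refine ⟨P, fun i => ⟨hP i, fun v hv => ?_⟩⟩
        ext x
        rw [mulVec_single_one, mulVec_single_one, Matrix.col_apply, Matrix.col_apply,
          hPv i v (hS u hu v hv), distMatrix, Matrix.of_apply, SimpleGraph.dist_comm]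
    obtain ⟨pB, hpB⟩ := key B fun u hu v hv => iff_of_true hu hv
    obtain ⟨pC, hpC⟩ := key C fun u hu v hv =>
      iff_of_false (fun h => hbip.2.1 u ⟨h, hu⟩) fun h => hbip.2.1 v ⟨h, hv⟩
    exact ⟨pB, pC, fun i _ => ⟨(hpB i).1, (hpC i).1, (hpB i).2, (hpC i).2⟩⟩
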